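/- (Outer-loop global convergence, natural policy gradient.) Suppose Assumption 2.4 holds, K⁰ ∈ 𝒦, and 0 < α ≤ 1 / (2 max_{0≤t≤N−1} ‖G^{K⁰}_t‖). Define iterates K^{k+1}_t := K^k_t − 2α F^{K^k}_t. Then for every integer M ≥ 1, (1/M) Σ_{k=0}^{M−1} Σ_{t=0}^{N−1} ‖F^{K^k}_t‖_F² ≤ Σ_{t=0}^{N} Tr((P^{K⁰}_t − P*_t) Σ⁰_t) / (2αφM); in particular, the running average of the squared natural-gradient norms converges to 0 at rate O(1/M). -/

import Mathlib

open Matrix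

noncomputable section

/-- Rayleigh-quotient value set of a square real matrix. -/
def rayleighSet {a : ℕ} (M : Matrix (Fin a) (Fin a) ℝ) : Set ℝ :=
  { r : ℝ | ∃ x : Fin a → ℝ, x ⬝ᵥ x = 1 ∧ r = x ⬝ᵥ M.mulVec x }

/-- Smallest eigenvalue (of a symmetric matrix), via the Rayleigh characterization. -/
def eigMin {a : ℕ} (M : Matrix (Fin a) (Fin a) ℝ) : ℝ := sInf (rayleighSet M)

/-- Largest eigenvalue (of a symmetric matrix), via the Rayleigh characterization. -/
def eigMax {a : ℕ} (M : Matrix (Fin a) (Fin a) ℝ) : ℝ := sSup (rayleighSet M)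

/-- Operator (spectral) norm of a real matrix. -/
def opNorm {a b : ℕ} (M : Matrix (Fin a) (Fin b) ℝ) : ℝ := Real.sqrt (eigMax (Mᵀ * M))

/-- Squared Frobenius norm. -/
def frobNormSq {a b : ℕ} (M : Matrix (Fin a) (Fin b) ℝ) : ℝ := ∑ i, ∑ j, (M i j) ^ 2

/-- Frobenius norm. -/
def frobNorm {a b : ℕ} (M : Matrix (Fin a) (Fin b) ℝ) : ℝ := Real.sqrt (frobNormSq M)

/-- Extend a finite tuple to a function on `ℕ` by zero. -/
def padZero {α : Type*} [Zero α] {N : ℕ} (f : Fin N → α) : ℕ → α :=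
  fun t => if h : t < N then f ⟨t, h⟩ else 0

/-- Data of a finite-horizon zero-sum LQ dynamic game with horizon `N`. -/
structure LQGame (m d n N : ℕ) where
  A : ℕ → Matrix (Fin m) (Fin m) ℝ
  B : ℕ → Matrix (Fin m) (Fin d) ℝ
  D : ℕ → Matrix (Fin m) (Fin n) ℝ
  Q : ℕ → Matrix (Fin m) (Fin m) ℝ
  QN : Matrix (Fin m) (Fin m) ℝ
  Ru : ℕ → Matrix (Fin d) (Fin d) ℝ
  Rw : ℕ → Matrix (Fin n) (Fin n) ℝ
  Sig : ℕ → Matrix (Fin m) (Fin m) ℝ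
  hQ : ∀ t < N, (Q t).PosSemidef
  hQN : QN.PosSemidef
  hRu : ∀ t < N, (Ru t).PosDef
  hRw : ∀ t < N, (Rw t).PosDef
  hSig : ∀ t ≤ N, (Sig t).PosDef

namespace LQGame

variable {m d n N : ℕ}

/-- Value matrices `P^{K,L}` indexed by the number `j` of steps before the terminal
time, i.e. `PKLaux g K L j = P^{K,L}_{N-j}`. -/
def PKLaux (g : LQGame m d n N) (K : ℕ → Matrix (Fin d) (Fin m) ℝ)
    (L : ℕ → Matrix (Fin n) (Fin m) ℝ) : ℕ → Matrix (Fin m) (Fin m) ℝ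
  | 0 => g.QN
  | j + 1 =>
      (g.A (N - (j+1)) - g.B (N - (j+1)) * K (N - (j+1)) - g.D (N - (j+1)) * L (N - (j+1)))ᵀ *
          PKLaux g K L j *
          (g.A (N - (j+1)) - g.B (N - (j+1)) * K (N - (j+1)) - g.D (N - (j+1)) * L (N - (j+1)))
        + g.Q (N - (j+1)) + (K (N - (j+1)))ᵀ * g.Ru (N - (j+1)) * K (N - (j+1))
        - (L (N - (j+1)))ᵀ * g.Rw (N - (j+1)) * L (N - (j+1))

/-- Value matrix `P^{K,L}_t`. -/
def PKL (g : LQGame m d n N) (K : ℕ → Matrix (Fin d) (Fin m) ℝ)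
    (L : ℕ → Matrix (Fin n) (Fin m) ℝ) (t : ℕ) : Matrix (Fin m) (Fin m) ℝ :=
  PKLaux g K L (N - t)

/-- Inner-loop Riccati matrices indexed by the number `j` of steps before the terminal
time, i.e. `PKaux g K j = P^K_{N-j}`. -/
def PKaux (g : LQGame m d n N) (K : ℕ → Matrix (Fin d) (Fin m) ℝ) :
    ℕ → Matrix (Fin m) (Fin m) ℝ
  | 0 => g.QN
  | j + 1 =>
      g.Q (N - (j+1)) + (K (N - (j+1)))ᵀ * g.Ru (N - (j+1)) * K (N - (j+1))
        + (g.A (N - (j+1)) - g.B (N - (j+1)) * K (N - (j+1)))ᵀ *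
          (PKaux g K j + PKaux g K j * g.D (N - (j+1)) *
            (g.Rw (N - (j+1)) - (g.D (N - (j+1)))ᵀ * PKaux g K j * g.D (N - (j+1)))⁻¹ *
            (g.D (N - (j+1)))ᵀ * PKaux g K j) *
          (g.A (N - (j+1)) - g.B (N - (j+1)) * K (N - (j+1)))

/-- Inner-loop Riccati matrix `P^K_t`. -/
def PK (g : LQGame m d n N) (K : ℕ → Matrix (Fin d) (Fin m) ℝ) (t : ℕ) :
    Matrix (Fin m) (Fin m) ℝ :=
  PKaux g K (N - t)

/-- `P̃^K_{t+1}`. -/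
def Ptilde (g : LQGame m d n N) (K : ℕ → Matrix (Fin d) (Fin m) ℝ) (t : ℕ) :
    Matrix (Fin m) (Fin m) ℝ :=
  g.PK K (t+1) + g.PK K (t+1) * g.D t *
    (g.Rw t - (g.D t)ᵀ * g.PK K (t+1) * g.D t)⁻¹ * (g.D t)ᵀ * g.PK K (t+1)

/-- `K ∈ 𝒦`. -/
def Admissible (g : LQGame m d n N) (K : ℕ → Matrix (Fin d) (Fin m) ℝ) : Prop :=
  ∀ t < N, (g.Rw t - (g.D t)ᵀ * g.PK K (t+1) * g.D t).PosDef

/-- The inner maximizer `L(K)`. -/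
def Lopt (g : LQGame m d n N) (K : ℕ → Matrix (Fin d) (Fin m) ℝ) (t : ℕ) :
    Matrix (Fin n) (Fin m) ℝ :=
  (-(g.Rw t) + (g.D t)ᵀ * g.PK K (t+1) * g.D t)⁻¹ *
    ((g.D t)ᵀ * g.PK K (t+1) * (g.A t - g.B t * K t))

/-- State covariances `X^{K,L}_t`. -/
def Xcov (g : LQGame m d n N) (K : ℕ → Matrix (Fin d) (Fin m) ℝ)
    (L : ℕ → Matrix (Fin n) (Fin m) ℝ) : ℕ → Matrix (Fin m) (Fin m) ℝ
  | 0 => g.Sig 0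
  | t + 1 =>
      (g.A t - g.B t * K t - g.D t * L t) * Xcov g K L t *
        (g.A t - g.B t * K t - g.D t * L t)ᵀ + g.Sig (t+1)

/-- The game value `G(K,L)`. -/
def value (g : LQGame m d n N) (K : ℕ → Matrix (Fin d) (Fin m) ℝ)
    (L : ℕ → Matrix (Fin n) (Fin m) ℝ) : ℝ :=
  ∑ t ∈ Finset.range (N+1), ((g.PKL K L t) * g.Sig t).trace

/-- `E^{K,L}_t`. -/
def Emat (g : LQGame m d n N) (K : ℕ → Matrix (Fin d) (Fin m) ℝ)
    (L : ℕ → Matrix (Fin n) (Fin m) ℝ) (t : ℕ) : Matrix (Fin n) (Fin m) ℝ :=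
  (-(g.Rw t) + (g.D t)ᵀ * g.PKL K L (t+1) * g.D t) * L t -
    (g.D t)ᵀ * g.PKL K L (t+1) * (g.A t - g.B t * K t)

/-- `H^{K,L}_t`. -/
def Hmat (g : LQGame m d n N) (K : ℕ → Matrix (Fin d) (Fin m) ℝ)
    (L : ℕ → Matrix (Fin n) (Fin m) ℝ) (t : ℕ) : Matrix (Fin n) (Fin n) ℝ :=
  g.Rw t - (g.D t)ᵀ * g.PKL K L (t+1) * g.D t

/-- `F^K_t`. -/
def Fmat (g : LQGame m d n N) (K : ℕ → Matrix (Fin d) (Fin m) ℝ) (t : ℕ) :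
    Matrix (Fin d) (Fin m) ℝ :=
  (g.Ru t + (g.B t)ᵀ * g.Ptilde K t * g.B t) * K t - (g.B t)ᵀ * g.Ptilde K t * g.A t

/-- `G^K_t`. -/
def Gmat (g : LQGame m d n N) (K : ℕ → Matrix (Fin d) (Fin m) ℝ) (t : ℕ) :
    Matrix (Fin d) (Fin d) ℝ :=
  g.Ru t + (g.B t)ᵀ * g.Ptilde K t * g.B t

/-- Game Riccati recursion `P*` indexed by steps before terminal time. -/
def Pstaraux (g : LQGame m d n N) : ℕ → Matrix (Fin m) (Fin m) ℝ
  | 0 => g.QN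
  | j + 1 =>
      g.Q (N - (j+1)) + (g.A (N - (j+1)))ᵀ * Pstaraux g j *
        (1 + (g.B (N - (j+1)) * (g.Ru (N - (j+1)))⁻¹ * (g.B (N - (j+1)))ᵀ
            - g.D (N - (j+1)) * (g.Rw (N - (j+1)))⁻¹ * (g.D (N - (j+1)))ᵀ) * Pstaraux g j)⁻¹ *
        g.A (N - (j+1))

/-- `P*_t`. -/
def Pstar (g : LQGame m d n N) (t : ℕ) : Matrix (Fin m) (Fin m) ℝ :=
  Pstaraux g (N - t)

/-- `Λ_t` of the game Riccati recursion. -/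
def LambdaStar (g : LQGame m d n N) (t : ℕ) : Matrix (Fin m) (Fin m) ℝ :=
  1 + (g.B t * (g.Ru t)⁻¹ * (g.B t)ᵀ - g.D t * (g.Rw t)⁻¹ * (g.D t)ᵀ) * g.Pstar (t+1)

/-- Assumption 2.4. -/
def Assumption24 (g : LQGame m d n N) : Prop :=
  (∀ t < N, IsUnit (g.LambdaStar t)) ∧ (∀ t ≤ N, (g.Pstar t).PosSemidef) ∧
    (∀ t < N, (g.Rw t - (g.D t)ᵀ * g.Pstar (t+1) * g.D t).PosDef)

/-- `φ := min_{0 ≤ t ≤ N} λ_min(Σ⁰_t)`. -/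
def phi (g : LQGame m d n N) : ℝ :=
  (Finset.range (N+1)).inf' (Finset.nonempty_range_iff.mpr (Nat.succ_ne_zero N))
    (fun t => eigMin (g.Sig t))

end LQGame

namespace Matrix

variable {ι κ τ : Type*}

lemma IsHermitian.transpose_eq {P : Matrix ι ι ℝ} (hP : P.IsHermitian) : Pᵀ = P := by
  simpa [conjTranspose_eq_transpose_of_trivial] using hP.eq

variable [Fintype ι] [Fintype κ] [Fintype τ]

lemma PosSemidef.transpose_mul_mul {P : Matrix ι ι ℝ} (hP : P.PosSemidef) (X : Matrix ι κ ℝ) :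
    (Xᵀ * P * X).PosSemidef := by
  simpa [conjTranspose_eq_transpose_of_trivial] using hP.conjTranspose_mul_mul_same X

open scoped MatrixOrder in
lemma PosSemidef.trace_mul_nonneg [DecidableEq ι] {P S : Matrix ι ι ℝ} (hP : P.PosSemidef)
    (hS : S.PosSemidef) : 0 ≤ (P * S).trace := by
  obtain ⟨X, rfl⟩ := CStarAlgebra.nonneg_iff_eq_star_mul_self.mp hS.nonneg
  rw [star_eq_conjTranspose, ← Matrix.mul_assoc, Matrix.trace_mul_comm, ← Matrix.mul_assoc]
  exact (hP.mul_mul_conjTranspose_same X).trace_nonneg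

lemma posDef_sub_of_posSemidef_sub {R : Matrix κ κ ℝ} {D : Matrix ι κ ℝ} {P P' : Matrix ι ι ℝ}
    (hle : (P - P').PosSemidef) (hH : (R - Dᵀ * P * D).PosDef) :
    (R - Dᵀ * P' * D).PosDef := by
  have h := hH.add_posSemidef (hle.transpose_mul_mul D)
  rw [Matrix.mul_sub, Matrix.sub_mul] at h
  simpa using h

/-- One-stage cost of the gain `K` with continuation value matrix `P`. -/
def stageCost (A : Matrix ι ι ℝ) (B : Matrix ι τ ℝ) (R : Matrix τ τ ℝ) (P : Matrix ι ι ℝ)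
    (K : Matrix τ ι ℝ) : Matrix ι ι ℝ :=
  Kᵀ * R * K + (A - B * K)ᵀ * P * (A - B * K)

lemma stageCost_add {A : Matrix ι ι ℝ} {B : Matrix ι τ ℝ} {R : Matrix τ τ ℝ}
    {P : Matrix ι ι ℝ} (hR : R.IsHermitian) (hP : P.IsHermitian) (K Δ : Matrix τ ι ℝ) :
    stageCost A B R P (K + Δ) = stageCost A B R P K
      + Δᵀ * ((R + Bᵀ * P * B) * K - Bᵀ * P * A)
      + ((R + Bᵀ * P * B) * K - Bᵀ * P * A)ᵀ * Δ
      + Δᵀ * (R + Bᵀ * P * B) * Δ := by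
  simp only [stageCost, Matrix.transpose_add, Matrix.transpose_sub, Matrix.transpose_mul,
    Matrix.transpose_transpose, hR.transpose_eq, hP.transpose_eq, Matrix.mul_add,
    Matrix.add_mul, Matrix.mul_sub, Matrix.sub_mul, Matrix.mul_assoc]
  abel

/-- The stage cost is monotone in the continuation value matrix. -/
lemma stageCost_sub_posSemidef {A : Matrix ι ι ℝ} {B : Matrix ι τ ℝ}
    {R : Matrix τ τ ℝ} {P P' : Matrix ι ι ℝ}
    (hle : (P - P').PosSemidef) (K : Matrix τ ι ℝ) :
    (stageCost A B R P K - stageCost A B R P' K).PosSemidef := by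
  convert hle.transpose_mul_mul (A - B * K) using 1
  rw [stageCost, stageCost, Matrix.mul_sub _ P P', Matrix.sub_mul _ _ (A - B * K)]
  abel

/-- A natural-gradient step with step size bounded by the inverse curvature decreases the
one-stage cost by at least `c Fᵀ F`. -/
lemma stageCost_descent [DecidableEq τ] {A : Matrix ι ι ℝ} {B : Matrix ι τ ℝ}
    {R : Matrix τ τ ℝ} {P : Matrix ι ι ℝ} (hR : R.IsHermitian) (hP : P.IsHermitian)
    (K F : Matrix τ ι ℝ) (hF : F = (R + Bᵀ * P * B) * K - Bᵀ * P * A) {c : ℝ} (hc : 0 ≤ c)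
    (hG : (1 - c • (R + Bᵀ * P * B)).PosSemidef) :
    (stageCost A B R P K - stageCost A B R P (K - c • F) - c • (Fᵀ * F)).PosSemidef := by
  have h := (hG.transpose_mul_mul F).smul hc
  rw [sub_eq_add_neg K, stageCost_add hR hP, ← hF]
  convert h using 1
  simp only [Matrix.transpose_neg, Matrix.transpose_smul, Matrix.neg_mul, Matrix.mul_neg,
    Matrix.smul_mul, Matrix.mul_smul, Matrix.mul_sub, Matrix.sub_mul, Matrix.mul_one, smul_sub,
    smul_neg]
  abel

variable [DecidableEq κ]

/-- The disturbance-robust version `P + P D (R - Dᵀ P D)⁻¹ Dᵀ P` of a value matrix `P`. -/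
def robustify (R : Matrix κ κ ℝ) (D : Matrix ι κ ℝ) (P : Matrix ι ι ℝ) : Matrix ι ι ℝ :=
  P + P * D * (R - Dᵀ * P * D)⁻¹ * Dᵀ * P

lemma robustify_posSemidef {R : Matrix κ κ ℝ} {D : Matrix ι κ ℝ} {P : Matrix ι ι ℝ}
    (hP : P.PosSemidef) (hH : (R - Dᵀ * P * D).PosDef) : (robustify R D P).PosSemidef := by
  have h := hP.add (hH.inv.posSemidef.transpose_mul_mul (Dᵀ * P))
  simpa [robustify, hP.isHermitian.transpose_eq, Matrix.mul_assoc] using h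

variable [DecidableEq ι]

/-- Completion of the square in the disturbance gain `W`. -/
lemma robustify_eq_add_sq {R : Matrix κ κ ℝ} {D : Matrix ι κ ℝ} {P : Matrix ι ι ℝ}
    (hP : P.IsHermitian) (hH : (R - Dᵀ * P * D).PosDef) (W : Matrix κ ι ℝ) :
    robustify R D P = (1 + D * W)ᵀ * P * (1 + D * W) - Wᵀ * R * W
      + (W - (R - Dᵀ * P * D)⁻¹ * Dᵀ * P)ᵀ * (R - Dᵀ * P * D)
        * (W - (R - Dᵀ * P * D)⁻¹ * Dᵀ * P) := by
  have hdet := (Matrix.isUnit_iff_isUnit_det _).mp hH.isUnit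
  have hHT := hH.isHermitian.transpose_eq
  have hPT := hP.transpose_eq
  unfold robustify
  generalize hHdef : R - Dᵀ * P * D = H at *
  obtain rfl : R = H + Dᵀ * P * D := by rw [← hHdef]; abel
  have hiT : (H⁻¹)ᵀ = H⁻¹ := by rw [Matrix.transpose_nonsing_inv, hHT]
  have h₁ : ∀ X : Matrix κ ι ℝ, H * (H⁻¹ * X) = X := fun X => by
    rw [← Matrix.mul_assoc, Matrix.mul_nonsing_inv _ hdet, Matrix.one_mul]
  have h₂ : ∀ X : Matrix κ ι ℝ, H⁻¹ * (H * X) = X := fun X => by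
    rw [← Matrix.mul_assoc, Matrix.nonsing_inv_mul _ hdet, Matrix.one_mul]
  simp only [Matrix.transpose_add, Matrix.transpose_sub, Matrix.transpose_mul,
    Matrix.transpose_one, Matrix.transpose_transpose, hiT, hPT, Matrix.mul_add, Matrix.add_mul,
    Matrix.mul_sub, Matrix.sub_mul, Matrix.mul_assoc, Matrix.mul_one, Matrix.one_mul, h₁, h₂]
  abel

lemma robustify_mono {R : Matrix κ κ ℝ} {D : Matrix ι κ ℝ} {P P' : Matrix ι ι ℝ}
    (hP : P.IsHermitian) (hP' : P'.IsHermitian) (hle : (P - P').PosSemidef)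
    (hH : (R - Dᵀ * P * D).PosDef) : (robustify R D P - robustify R D P').PosSemidef := by
  have hH' := posDef_sub_of_posSemidef_sub hle hH
  set W := (R - Dᵀ * P' * D)⁻¹ * Dᵀ * P' with hW
  have h := (hle.transpose_mul_mul (1 + D * W)).add (hH.posSemidef.transpose_mul_mul
    (W - (R - Dᵀ * P * D)⁻¹ * Dᵀ * P))
  rw [robustify_eq_add_sq hP hH W, robustify_eq_add_sq hP' hH' W, ← hW]
  convert h using 1
  rw [Matrix.mul_sub _ P P', Matrix.sub_mul _ _ (1 + D * W), sub_self W, Matrix.mul_zero]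
  abel

lemma robustify_mul_one_sub {R : Matrix κ κ ℝ} {D : Matrix ι κ ℝ}
    {P : Matrix ι ι ℝ} (hR : R.PosDef) (hH : (R - Dᵀ * P * D).PosDef) :
    robustify R D P * (1 - D * R⁻¹ * Dᵀ * P) = P := by
  have hdet := (Matrix.isUnit_iff_isUnit_det _).mp hH.isUnit
  have hRdet := (Matrix.isUnit_iff_isUnit_det _).mp hR.isUnit
  unfold robustify
  generalize hHdef : R - Dᵀ * P * D = H at *
  have hinv : H⁻¹ = R⁻¹ + H⁻¹ * Dᵀ * P * D * R⁻¹ := by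
    have h : Dᵀ * P * D = R - H := by rw [← hHdef]; abel
    calc H⁻¹ = R⁻¹ + H⁻¹ * (R - H) * R⁻¹ := by
          rw [Matrix.mul_sub, Matrix.sub_mul, Matrix.nonsing_inv_mul _ hdet,
            Matrix.mul_nonsing_inv_cancel_right _ _ hRdet, Matrix.one_mul]
          abel
      _ = _ := by rw [← h]; simp only [Matrix.mul_assoc]
  have hsplit := congrArg (fun Z => P * D * Z * Dᵀ * P) hinv
  simp only [Matrix.mul_add, Matrix.add_mul, Matrix.mul_sub, Matrix.mul_one,
    Matrix.mul_assoc] at hsplit ⊢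
  rw [hsplit]
  abel

/-- The game Riccati map is a lower bound for the one-stage cost of every gain. -/
lemma riccati_le_stageCost [DecidableEq τ] {A : Matrix ι ι ℝ} {B : Matrix ι τ ℝ}
    {D : Matrix ι κ ℝ} {R : Matrix τ τ ℝ} {S : Matrix κ κ ℝ} {P : Matrix ι ι ℝ}
    (hR : R.PosDef) (hS : S.PosDef) (hP : P.PosSemidef) (hH : (S - Dᵀ * P * D).PosDef)
    (hΛ : IsUnit (1 + (B * R⁻¹ * Bᵀ - D * S⁻¹ * Dᵀ) * P)) (K : Matrix τ ι ℝ) :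
    (stageCost A B R (robustify S D P) K
      - Aᵀ * P * (1 + (B * R⁻¹ * Bᵀ - D * S⁻¹ * Dᵀ) * P)⁻¹ * A).PosSemidef := by
  have hT := robustify_posSemidef hP hH
  have hRdet := (Matrix.isUnit_iff_isUnit_det _).mp hR.isUnit
  have hΛinv := Matrix.mul_nonsing_inv _ ((Matrix.isUnit_iff_isUnit_det _).mp hΛ)
  set Z := (1 + (B * R⁻¹ * Bᵀ - D * S⁻¹ * Dᵀ) * P)⁻¹
  set T := robustify S D P
  set Kopt := R⁻¹ * (Bᵀ * (P * (Z * A))) with hKopt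
  have hclosed : A - B * Kopt = (1 - D * S⁻¹ * Dᵀ * P) * (Z * A) := by
    have h := congrArg (· * A) hΛinv
    simp only [Matrix.one_mul] at h
    rw [hKopt]
    nth_rewrite 1 [← h]
    simp only [Matrix.add_mul, Matrix.sub_mul, Matrix.one_mul, Matrix.mul_assoc]
    abel
  have hTclosed : T * (A - B * Kopt) = P * (Z * A) := by
    rw [hclosed, ← Matrix.mul_assoc, robustify_mul_one_sub hS hH]
  have hRK : R * Kopt = Bᵀ * (P * (Z * A)) := Matrix.mul_nonsing_inv_cancel_left _ _ hRdet
  have hstat : (R + Bᵀ * T * B) * Kopt - Bᵀ * T * A = 0 := by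
    have h : (R + Bᵀ * T * B) * Kopt - Bᵀ * T * A = R * Kopt - Bᵀ * (T * (A - B * Kopt)) := by
      simp only [Matrix.add_mul, Matrix.mul_sub, Matrix.mul_assoc]
      abel
    rw [h, hTclosed, hRK, sub_self]
  have hval : stageCost A B R T Kopt = Aᵀ * P * Z * A := by
    rw [stageCost, Matrix.mul_assoc Koptᵀ, Matrix.mul_assoc _ T, hTclosed, hRK,
      Matrix.transpose_sub, Matrix.transpose_mul B, Matrix.sub_mul]
    simp only [Matrix.mul_assoc]
    abel
  have hG := (hR.posSemidef.add (hT.transpose_mul_mul B)).transpose_mul_mul (K - Kopt)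
  have hexp := stageCost_add (A := A) (B := B) hR.isHermitian hT.isHermitian Kopt (K - Kopt)
  rw [hstat, add_sub_cancel] at hexp
  rw [hexp, hval]
  simpa using hG

end Matrix

section Rayleigh

variable {a b : ℕ}

lemma isCompact_rayleighSet (M : Matrix (Fin a) (Fin a) ℝ) : IsCompact (rayleighSet M) := by
  have hsphere : IsCompact {x : Fin a → ℝ | x ⬝ᵥ x = 1} := by
    refine Metric.isCompact_of_isClosed_isBounded
      (isClosed_eq (by unfold dotProduct; fun_prop) continuous_const)
      ((Metric.isBounded_closedBall (x := (0 : Fin a → ℝ)) (r := 1)).subset fun x hx => ?_)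
    rw [mem_closedBall_zero_iff, pi_norm_le_iff_of_nonneg zero_le_one]
    intro i
    have hi : x i * x i ≤ x ⬝ᵥ x :=
      Finset.single_le_sum (f := fun j => x j * x j) (fun j _ => mul_self_nonneg _)
        (Finset.mem_univ i)
    rw [show x ⬝ᵥ x = 1 from hx] at hi
    rw [Real.norm_eq_abs, abs_le]
    constructor <;> nlinarith
  have himage : rayleighSet M =
      Set.image (fun x => x ⬝ᵥ M *ᵥ x) {x : Fin a → ℝ | x ⬝ᵥ x = 1} := by
    ext r
    simp [rayleighSet, eq_comm]
  rw [himage]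
  exact hsphere.image (by unfold dotProduct Matrix.mulVec dotProduct; fun_prop)

lemma exists_unit_scaling {x : Fin a → ℝ} (hx : x ≠ 0) :
    ∃ y : Fin a → ℝ, y ⬝ᵥ y = 1 ∧ ∀ M : Matrix (Fin a) (Fin a) ℝ,
      x ⬝ᵥ M *ᵥ x = (x ⬝ᵥ x) * (y ⬝ᵥ M *ᵥ y) := by
  have hpos : 0 < x ⬝ᵥ x :=
    lt_of_le_of_ne (Finset.sum_nonneg fun i _ => mul_self_nonneg _)
      (Ne.symm (by simpa using hx))
  have hsq := Real.mul_self_sqrt hpos.le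
  have hs : Real.sqrt (x ⬝ᵥ x) ≠ 0 := (Real.sqrt_pos.mpr hpos).ne'
  refine ⟨(Real.sqrt (x ⬝ᵥ x))⁻¹ • x, ?_, fun M => ?_⟩
  · simp only [smul_dotProduct, dotProduct_smul, smul_eq_mul]
    field_simp
    rw [pow_two, hsq]
  · simp only [Matrix.mulVec_smul, smul_dotProduct, dotProduct_smul, smul_eq_mul]
    field_simp
    rw [pow_two, hsq]

lemma dotProduct_mulVec_le_eigMax (M : Matrix (Fin a) (Fin a) ℝ) (x : Fin a → ℝ) :
    x ⬝ᵥ M *ᵥ x ≤ eigMax M * (x ⬝ᵥ x) := by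
  rcases eq_or_ne x 0 with rfl | hx
  · simp
  obtain ⟨y, hy, h⟩ := exists_unit_scaling hx
  rw [h, mul_comm]
  exact mul_le_mul_of_nonneg_right (le_csSup (isCompact_rayleighSet M).bddAbove ⟨y, hy, rfl⟩)
    (Finset.sum_nonneg fun i _ => mul_self_nonneg _)

lemma eigMin_le_dotProduct_mulVec (M : Matrix (Fin a) (Fin a) ℝ) (x : Fin a → ℝ) :
    eigMin M * (x ⬝ᵥ x) ≤ x ⬝ᵥ M *ᵥ x := by
  rcases eq_or_ne x 0 with rfl | hx
  · simp
  obtain ⟨y, hy, h⟩ := exists_unit_scaling hx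
  rw [h, mul_comm]
  exact mul_le_mul_of_nonneg_left (csInf_le (isCompact_rayleighSet M).bddBelow ⟨y, hy, rfl⟩)
    (Finset.sum_nonneg fun i _ => mul_self_nonneg _)

lemma eigMin_pos {M : Matrix (Fin a) (Fin a) ℝ} (hM : M.PosDef) (ha : 0 < a) :
    0 < eigMin M := by
  have hne : (rayleighSet M).Nonempty := ⟨_, Pi.single ⟨0, ha⟩ 1, by simp, rfl⟩
  obtain ⟨x, hx, h⟩ := (isCompact_rayleighSet M).sInf_mem hne
  rw [eigMin, h]
  have hx0 : x ≠ 0 := by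
    rintro rfl
    simp at hx
  simpa using hM.dotProduct_mulVec_pos hx0

lemma dotProduct_mulVec_le_opNorm (M : Matrix (Fin a) (Fin a) ℝ) (x : Fin a → ℝ) :
    x ⬝ᵥ M *ᵥ x ≤ opNorm M * (x ⬝ᵥ x) := by
  have hxx : 0 ≤ x ⬝ᵥ x := Finset.sum_nonneg fun i _ => mul_self_nonneg _
  have hMM : (M *ᵥ x) ⬝ᵥ (M *ᵥ x) ≤ eigMax (Mᵀ * M) * (x ⬝ᵥ x) := by
    refine le_trans (le_of_eq ?_) (dotProduct_mulVec_le_eigMax _ x)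
    rw [← Matrix.mulVec_mulVec, Matrix.dotProduct_mulVec x, Matrix.vecMul_transpose]
  have hcs : (x ⬝ᵥ M *ᵥ x) ^ 2 ≤ (x ⬝ᵥ x) * ((M *ᵥ x) ⬝ᵥ (M *ᵥ x)) := by
    simpa [dotProduct, pow_two] using
      Finset.sum_mul_sq_le_sq_mul_sq Finset.univ x (M *ᵥ x)
  calc x ⬝ᵥ M *ᵥ x ≤ Real.sqrt (eigMax (Mᵀ * M) * (x ⬝ᵥ x) ^ 2) :=
        Real.le_sqrt_of_sq_le (by nlinarith)
    _ = opNorm M * (x ⬝ᵥ x) := by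
        rw [Real.sqrt_mul' _ (sq_nonneg _), Real.sqrt_sq hxx, opNorm]

lemma eigMin_mul_frobNormSq_le_trace (F : Matrix (Fin b) (Fin a) ℝ)
    (S : Matrix (Fin a) (Fin a) ℝ) :
    eigMin S * frobNormSq F ≤ (Fᵀ * F * S).trace := by
  have htrace : (Fᵀ * F * S).trace = ∑ i, F i ⬝ᵥ S *ᵥ F i := by
    rw [Matrix.mul_assoc, Matrix.trace_mul_comm]
    refine Finset.sum_congr rfl fun i _ => ?_
    rw [Matrix.dotProduct_mulVec]
    rfl
  rw [htrace, frobNormSq, Finset.mul_sum]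
  refine Finset.sum_le_sum fun i _ => ?_
  simpa [dotProduct, pow_two] using eigMin_le_dotProduct_mulVec S (F i)

end Rayleigh

namespace LQGame

variable {m d n N : ℕ} (g : LQGame m d n N)

lemma PK_terminal (K : ℕ → Matrix (Fin d) (Fin m) ℝ) : g.PK K N = g.QN := by
  simp [PK, PKaux]

lemma Pstar_terminal : g.Pstar N = g.QN := by
  simp [Pstar, Pstaraux]

lemma PK_eq (K : ℕ → Matrix (Fin d) (Fin m) ℝ) {t : ℕ} (ht : t < N) :
    g.PK K t = g.Q t + stageCost (g.A t) (g.B t) (g.Ru t) (g.Ptilde K t) (K t) := by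
  obtain ⟨j, hj⟩ : ∃ j, N - t = j + 1 := ⟨N - (t + 1), by omega⟩
  have hjt : N - (j + 1) = t := by omega
  have hj' : N - (t + 1) = j := by omega
  simp only [PK, Ptilde, hj, hj', PKaux, hjt, stageCost]
  abel

lemma Pstar_eq {t : ℕ} (ht : t < N) :
    g.Pstar t = g.Q t + (g.A t)ᵀ * g.Pstar (t + 1) * (g.LambdaStar t)⁻¹ * g.A t := by
  obtain ⟨j, hj⟩ : ∃ j, N - t = j + 1 := ⟨N - (t + 1), by omega⟩
  have hjt : N - (j + 1) = t := by omega
  have hj' : N - (t + 1) = j := by omega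
  simp only [Pstar, LambdaStar, hj, hj', Pstaraux, hjt]

lemma Ptilde_eq_robustify (K : ℕ → Matrix (Fin d) (Fin m) ℝ) (t : ℕ) :
    g.Ptilde K t = robustify (g.Rw t) (g.D t) (g.PK K (t + 1)) := rfl

variable {g}

lemma Admissible.PK_posSemidef {K : ℕ → Matrix (Fin d) (Fin m) ℝ} (hK : g.Admissible K)
    {t : ℕ} (ht : t ≤ N) : (g.PK K t).PosSemidef := by
  induction ht using Nat.decreasingInduction with
  | self => exact g.PK_terminal K ▸ g.hQN
  | of_succ t ht ih =>
    rw [g.PK_eq K ht]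
    exact (g.hQ t ht).add (((g.hRu t ht).posSemidef.transpose_mul_mul _).add
      ((robustify_posSemidef ih (hK t ht)).transpose_mul_mul _))

lemma Admissible.Ptilde_posSemidef {K : ℕ → Matrix (Fin d) (Fin m) ℝ} (hK : g.Admissible K)
    {t : ℕ} (ht : t < N) : (g.Ptilde K t).PosSemidef :=
  robustify_posSemidef (hK.PK_posSemidef ht) (hK t ht)

/-- The game value matrices bound every inner-loop value matrix from below. -/
lemma Admissible.PK_sub_Pstar_posSemidef {K : ℕ → Matrix (Fin d) (Fin m) ℝ}
    (hK : g.Admissible K) (hA : g.Assumption24) {t : ℕ} (ht : t ≤ N) :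
    (g.PK K t - g.Pstar t).PosSemidef := by
  obtain ⟨hΛ, hP, hH⟩ := hA
  induction ht using Nat.decreasingInduction with
  | self => simpa [PK_terminal, Pstar_terminal] using PosSemidef.zero
  | of_succ t ht ih =>
    have hmono := stageCost_sub_posSemidef (A := g.A t) (B := g.B t) (R := g.Ru t)
      (robustify_mono (hK.PK_posSemidef ht).isHermitian (hP _ ht).isHermitian ih (hK t ht)) (K t)
    have hlow := riccati_le_stageCost (A := g.A t) (g.hRu t ht) (g.hRw t ht) (hP _ ht) (hH t ht)
      (hΛ t ht) (K t)
    rw [g.PK_eq K ht, g.Pstar_eq ht, Ptilde_eq_robustify]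
    convert hmono.add hlow using 1
    rw [LambdaStar]
    abel

/-- A natural-gradient step preserves admissibility and decreases each value matrix
by at least `c Fᵀ F`. -/
lemma Admissible.npg_descent {K K' : ℕ → Matrix (Fin d) (Fin m) ℝ} (hK : g.Admissible K)
    {c : ℝ} (hc : 0 ≤ c) (hG : ∀ t < N, (1 - c • g.Gmat K t).PosSemidef)
    (hK' : ∀ t < N, K' t = K t - c • g.Fmat K t) :
    g.Admissible K' ∧ (∀ t < N, (1 - c • g.Gmat K' t).PosSemidef) ∧
      ∀ t < N, (g.PK K t - g.PK K' t - c • ((g.Fmat K t)ᵀ * g.Fmat K t)).PosSemidef := by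
  have hstage : ∀ t < N, (g.PK K' (t + 1)).IsHermitian →
      (g.PK K (t + 1) - g.PK K' (t + 1)).PosSemidef →
      (g.PK K t - g.PK K' t - c • ((g.Fmat K t)ᵀ * g.Fmat K t)).PosSemidef := by
    intro t ht hherm hle
    have hdesc := stageCost_descent (A := g.A t) (B := g.B t) (g.hRu t ht).isHermitian
      (hK.Ptilde_posSemidef ht).isHermitian (K t) (g.Fmat K t) rfl hc (hG t ht)
    have hmono := stageCost_sub_posSemidef (A := g.A t) (B := g.B t) (R := g.Ru t)
      (robustify_mono (hK.PK_posSemidef ht).isHermitian hherm hle (hK t ht)) (K' t)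
    rw [g.PK_eq K ht, g.PK_eq K' ht, g.Ptilde_eq_robustify K']
    rw [← g.Ptilde_eq_robustify K, hK' t ht] at hmono
    convert hdesc.add hmono using 1
    rw [hK' t ht]
    abel
  have hle : ∀ t ≤ N, (g.PK K' t).PosSemidef ∧ (g.PK K t - g.PK K' t).PosSemidef := by
    intro t ht
    induction ht using Nat.decreasingInduction with
    | self =>
      rw [PK_terminal, PK_terminal, sub_self]
      exact ⟨g.hQN, PosSemidef.zero⟩
    | of_succ t ht ih =>
      refine ⟨?_, ?_⟩
      · rw [g.PK_eq K' ht]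
        exact (g.hQ t ht).add (((g.hRu t ht).posSemidef.transpose_mul_mul _).add
          ((robustify_posSemidef ih.1
            (posDef_sub_of_posSemidef_sub ih.2 (hK t ht))).transpose_mul_mul _))
      · have hF : ((g.Fmat K t)ᵀ * g.Fmat K t).PosSemidef := by
          simpa using PosSemidef.one.transpose_mul_mul (g.Fmat K t)
        simpa using (hstage t ht ih.1.isHermitian ih.2).add (hF.smul hc)
  refine ⟨fun t ht => posDef_sub_of_posSemidef_sub (hle _ ht).2 (hK t ht), fun t ht => ?_,
    fun t ht => hstage t ht (hle _ ht).1.isHermitian (hle _ ht).2⟩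
  have hmono := robustify_mono (hK.PK_posSemidef ht).isHermitian (hle _ ht).1.isHermitian
    (hle _ ht).2 (hK t ht)
  convert (hG t ht).add ((hmono.transpose_mul_mul (g.B t)).smul hc) using 1
  rw [Gmat, Gmat, Ptilde_eq_robustify, Ptilde_eq_robustify, Matrix.mul_sub, Matrix.sub_mul,
    smul_sub, smul_add, smul_add]
  abel

lemma phi_pos (hm : 0 < m) : 0 < g.phi := by
  rw [phi, Finset.lt_inf'_iff]
  exact fun t ht => eigMin_pos (g.hSig t (Nat.lt_succ_iff.mp (Finset.mem_range.mp ht))) hm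

lemma phi_le {t : ℕ} (ht : t ≤ N) : g.phi ≤ eigMin (g.Sig t) :=
  Finset.inf'_le _ (Finset.mem_range.mpr (Nat.lt_succ_of_le ht))

lemma frobNormSq_nonneg {a b : ℕ} (F : Matrix (Fin a) (Fin b) ℝ) : 0 ≤ frobNormSq F :=
  Finset.sum_nonneg fun _ _ => Finset.sum_nonneg fun _ _ => sq_nonneg _

/-- The scaled squared natural-gradient norm is bounded by the decrease of the weighted value. -/
lemma sum_frobNormSq_le_of_descent {K K' : ℕ → Matrix (Fin d) (Fin m) ℝ} {c : ℝ} (hc : 0 ≤ c)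
    (h : ∀ t < N, (g.PK K t - g.PK K' t - c • ((g.Fmat K t)ᵀ * g.Fmat K t)).PosSemidef) :
    c * g.phi * ∑ t ∈ Finset.range N, frobNormSq (g.Fmat K t)
      ≤ ∑ t ∈ Finset.range (N + 1), (g.PK K t * g.Sig t).trace
        - ∑ t ∈ Finset.range (N + 1), (g.PK K' t * g.Sig t).trace := by
  rw [← Finset.sum_sub_distrib, Finset.sum_range_succ, PK_terminal, PK_terminal, sub_self,
    add_zero, Finset.mul_sum]
  refine Finset.sum_le_sum fun t ht => ?_
  have ht' := Finset.mem_range.mp ht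
  have htr := (h t ht').trace_mul_nonneg (g.hSig t ht'.le).posSemidef
  simp only [Matrix.sub_mul, Matrix.trace_sub, Matrix.smul_mul, Matrix.trace_smul,
    smul_eq_mul] at htr
  have hφ : g.phi * frobNormSq (g.Fmat K t) ≤ ((g.Fmat K t)ᵀ * g.Fmat K t * g.Sig t).trace :=
    (mul_le_mul_of_nonneg_right (phi_le ht'.le) (frobNormSq_nonneg _)).trans
      (eigMin_mul_frobNormSq_le_trace _ _)
  have := mul_le_mul_of_nonneg_left hφ hc
  rw [mul_assoc]
  linarith

/-- A step size below the inverse operator norm dominates the curvature matrix. -/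
lemma Admissible.one_sub_smul_Gmat_posSemidef {K : ℕ → Matrix (Fin d) (Fin m) ℝ}
    (hK : g.Admissible K) {t : ℕ} (ht : t < N) {c : ℝ} (hc : 0 ≤ c)
    (hcG : c * opNorm (g.Gmat K t) ≤ 1) : (1 - c • g.Gmat K t).PosSemidef := by
  have hG : (g.Gmat K t).IsHermitian :=
    ((g.hRu t ht).posSemidef.add ((hK.Ptilde_posSemidef ht).transpose_mul_mul _)).isHermitian
  refine PosSemidef.of_dotProduct_mulVec_nonneg ?_ fun x => ?_
  · simp [Matrix.IsHermitian, hG.transpose_eq]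
  · have hx : 0 ≤ x ⬝ᵥ x := Finset.sum_nonneg fun i _ => mul_self_nonneg _
    have h₁ := mul_le_mul_of_nonneg_left (dotProduct_mulVec_le_opNorm (g.Gmat K t) x) hc
    have h₂ := mul_le_mul_of_nonneg_right hcG hx
    simp only [star_trivial, Matrix.sub_mulVec, Matrix.one_mulVec, Matrix.smul_mulVec,
      dotProduct_sub, dotProduct_smul, smul_eq_mul]
    linarith

end LQGame

/-- outer-loop global convergence of natural policy gradient. -/
theorem LQGame.npg_outer_convergence {m d n N : ℕ} (g : LQGame m d n N)
    (hN : 0 < N) (hA : g.Assumption24)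
    (K0 : ℕ → Matrix (Fin d) (Fin m) ℝ) (hK0 : g.Admissible K0)
    (α : ℝ) (hα0 : 0 < α)
    (hα : α ≤ 1 / (2 * (Finset.range N).sup' (Finset.nonempty_range_iff.mpr hN.ne')
      (fun t => opNorm (g.Gmat K0 t))))
    (Kseq : ℕ → ℕ → Matrix (Fin d) (Fin m) ℝ) (hinit : Kseq 0 = K0)
    (hstep : ∀ k : ℕ, ∀ t < N, Kseq (k+1) t = Kseq k t - (2 * α) • g.Fmat (Kseq k) t) :
    ∀ M : ℕ, 0 < M →
      (1 / (M : ℝ)) * ∑ k ∈ Finset.range M, ∑ t ∈ Finset.range N, frobNormSq (g.Fmat (Kseq k) t)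
        ≤ (∑ t ∈ Finset.range (N+1), ((g.PK K0 t - g.Pstar t) * g.Sig t).trace)
          / (2 * α * g.phi * M) := by
  intro M hM
  have hM' : (0 : ℝ) < M := Nat.cast_pos.mpr hM
  rcases Nat.eq_zero_or_pos m with rfl | hm
  · simp [frobNormSq, Matrix.trace]
  have hc : 0 ≤ 2 * α := by positivity
  have hG0 : ∀ t < N, (1 - (2 * α) • g.Gmat K0 t).PosSemidef := by
    intro t ht
    refine hK0.one_sub_smul_Gmat_posSemidef ht hc ?_
    set s := (Finset.range N).sup' (Finset.nonempty_range_iff.mpr hN.ne')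
      (fun t => opNorm (g.Gmat K0 t))
    have hts : opNorm (g.Gmat K0 t) ≤ s :=
      Finset.le_sup' (fun t => opNorm (g.Gmat K0 t)) (Finset.mem_range.mpr ht)
    have hs : 0 < 2 * s := one_div_pos.mp (hα0.trans_le hα)
    rw [le_div_iff₀ hs] at hα
    nlinarith
  have hinv : ∀ k, g.Admissible (Kseq k) ∧
      ∀ t < N, (1 - (2 * α) • g.Gmat (Kseq k) t).PosSemidef := by
    intro k
    induction k with
    | zero => exact hinit ▸ ⟨hK0, hG0⟩
    | succ k ih =>
      have h := ih.1.npg_descent hc ih.2 (hstep k)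
      exact ⟨h.1, h.2.1⟩
  have htelescope : 2 * α * g.phi *
      ∑ k ∈ Finset.range M, ∑ t ∈ Finset.range N, frobNormSq (g.Fmat (Kseq k) t)
      ≤ ∑ t ∈ Finset.range (N + 1), (g.PK K0 t * g.Sig t).trace
        - ∑ t ∈ Finset.range (N + 1), (g.PK (Kseq M) t * g.Sig t).trace := by
    rw [← hinit, ← Finset.sum_range_sub'
      (fun k => ∑ t ∈ Finset.range (N + 1), (g.PK (Kseq k) t * g.Sig t).trace), Finset.mul_sum]
    exact Finset.sum_le_sum fun k _ => LQGame.sum_frobNormSq_le_of_descent hc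
      ((hinv k).1.npg_descent hc (hinv k).2 (hstep k)).2.2
  have hlower : ∑ t ∈ Finset.range (N + 1), (g.Pstar t * g.Sig t).trace
      ≤ ∑ t ∈ Finset.range (N + 1), (g.PK (Kseq M) t * g.Sig t).trace := by
    refine Finset.sum_le_sum fun t ht => ?_
    have ht' := Nat.lt_succ_iff.mp (Finset.mem_range.mp ht)
    have h := ((hinv M).1.PK_sub_Pstar_posSemidef hA ht').trace_mul_nonneg
      (g.hSig t ht').posSemidef
    rwa [Matrix.sub_mul, Matrix.trace_sub, sub_nonneg] at h
  have hφ : 0 < g.phi := LQGame.phi_pos hm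
  simp only [Matrix.sub_mul, Matrix.trace_sub, Finset.sum_sub_distrib]
  rw [one_div_mul_eq_div, ← div_div, div_le_div_iff_of_pos_right hM', le_div_iff₀ (by positivity),
    mul_comm]
  linarith
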